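/- arXiv:2501.00894 — 2 statements merged into one kernel-verified Lean document; each statement's English description precedes it below -/
import Mathlib

section
/- Let X be a real symmetric m×m matrix (m ≥ 2) such that both X_{1:(m−1),1:(m−1)} and X_{2:m,2:m} are positive semidefinite. Then X is positive semidefinite if and only if at least one inner-saturated submatrix of X has a nonnegative determinant. -/
open Matrix

/-- The principal submatrix `Y_{I,I}` of `Y` with rows and columns indexed by `I`. -/
def principalSub {n : ℕ} (Y : Matrix (Fin n) (Fin n) ℝ) (I : Finset (Fin n)) :
    Matrix I I ℝ :=
  Y.submatrix (fun i => (i : Fin n)) (fun i => (i : Fin n))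

/-- `I` is an inner-saturated index set of the `n × n` matrix `Y` (indices `0`-based):
`I = {0, n-1} ∪ J` where `J` is a set of inner indices (those strictly between `0` and `n-1`)
such that the corresponding columns of the inner block `Y_{1:(n-2),1:(n-2)}` form a maximal
linearly independent subset of the columns of the inner block (in particular `J = ∅` when
`n ≤ 2`, since then there are no inner indices). -/
def IsInnerSaturatedSet {n : ℕ} (Y : Matrix (Fin n) (Fin n) ℝ) (I : Finset (Fin n)) : Prop :=
  ∃ J : Finset (Fin n),
    (∀ j ∈ J, 0 < (j : ℕ) ∧ (j : ℕ) < n - 1) ∧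
    LinearIndependent ℝ
      (fun j : J => fun i : {i : Fin n // 0 < (i : ℕ) ∧ (i : ℕ) < n - 1} =>
        Y i.val (j : Fin n)) ∧
    Submodule.span ℝ (Set.range
        (fun j : J => fun i : {i : Fin n // 0 < (i : ℕ) ∧ (i : ℕ) < n - 1} =>
          Y i.val (j : Fin n))) =
      Submodule.span ℝ (Set.range
        (fun j : {i : Fin n // 0 < (i : ℕ) ∧ (i : ℕ) < n - 1} =>
          fun i : {i : Fin n // 0 < (i : ℕ) ∧ (i : ℕ) < n - 1} => Y i.val j.val)) ∧
    I = Finset.univ.filter (fun i : Fin n => (i : ℕ) = 0 ∨ (i : ℕ) = n - 1) ∪ J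

/-- The leading principal submatrix `X_{1:(m-1),1:(m-1)}` (`0`-based: rows/cols `0,…,m-2`). -/
def leadSub {m : ℕ} (X : Matrix (Fin m) (Fin m) ℝ) : Matrix (Fin (m - 1)) (Fin (m - 1)) ℝ :=
  X.submatrix (fun i => ⟨(i : ℕ), by omega⟩) (fun i => ⟨(i : ℕ), by omega⟩)

/-- The trailing principal submatrix `X_{2:m,2:m}` (`0`-based: rows/cols `1,…,m-1`). -/
def tailSub {m : ℕ} (X : Matrix (Fin m) (Fin m) ℝ) : Matrix (Fin (m - 1)) (Fin (m - 1)) ℝ :=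
  X.submatrix (fun i => ⟨(i : ℕ) + 1, by omega⟩) (fun i => ⟨(i : ℕ) + 1, by omega⟩)

/-- If a principal block of `X` is positive semidefinite and `w` is supported on that block with
`X *ᵥ w` vanishing on the support of `w`, then `X *ᵥ w` vanishes on the whole block. -/
theorem mulVec_eq_zero_of_posSemidef_block {α : Type*} [Fintype α] {X : Matrix α α ℝ}
    (p : α → Prop) (hp : (X.submatrix (Subtype.val : {i // p i} → α) Subtype.val).PosSemidef)
    {w : α → ℝ} (hw : ∀ i, w i ≠ 0 → p i) (h0 : ∀ i, w i ≠ 0 → (X *ᵥ w) i = 0)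
    {i : α} (hi : p i) : (X *ᵥ w) i = 0 := by
  classical
  have key : ∀ k : {i // p i},
      (X.submatrix (Subtype.val : {i // p i} → α) Subtype.val *ᵥ
        fun j : {i // p i} => w j) k
        = (X *ᵥ w) k := by
    intro k
    refine Fintype.sum_of_injective Subtype.val Subtype.val_injective _ _ ?_ fun _ => rfl
    intro j hj
    have : w j = 0 := by
      by_contra h
      exact hj ⟨⟨j, hw j h⟩, rfl⟩
    simp [this]
  have hz := (hp.dotProduct_mulVec_zero_iff fun j : {i // p i} => w j).1 (by
    refine Finset.sum_eq_zero fun k _ => ?_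
    rw [key]
    by_cases h : w k = 0
    · simp [h]
    · simp [h0 _ h])
  rw [← key ⟨i, hi⟩, hz]
  rfl

/-- A real symmetric `2 × 2` matrix with nonnegative diagonal and nonnegative determinant is
positive semidefinite. -/
theorem posSemidef_fin_two_of_det_nonneg {S : Matrix (Fin 2) (Fin 2) ℝ} (hS : S.IsHermitian)
    (hd : ∀ i, 0 ≤ S i i) (hdet : 0 ≤ S.det) : S.PosSemidef := by
  refine .of_dotProduct_mulVec_nonneg hS fun x => ?_
  have hs : S 1 0 = S 0 1 := by simpa using hS.apply 0 1
  rw [det_fin_two, hs] at hdet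
  have e : star x ⬝ᵥ (S *ᵥ x)
      = S 0 0 * x 0 ^ 2 + 2 * S 0 1 * x 0 * x 1 + S 1 1 * x 1 ^ 2 := by
    simp [dotProduct, mulVec, Fin.sum_univ_two, hs]
    ring
  rw [e]
  rcases (hd 0).eq_or_lt with h | h
  · have hb : S 0 1 = 0 := by
      rw [← h] at hdet
      nlinarith
    rw [← h, hb]
    have := mul_nonneg (hd 1) (sq_nonneg (x 1))
    linarith
  · refine nonneg_of_mul_nonneg_right ?_ h
    have := mul_nonneg hdet (sq_nonneg (x 1))
    nlinarith [sq_nonneg (S 0 0 * x 0 + S 0 1 * x 1)]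

/-- A symmetric matrix with a positive definite block of codimension two, whose two bordered
extensions of that block are positive semidefinite, is positive semidefinite as soon as its
determinant is nonnegative. -/
theorem posSemidef_of_bordered_of_det_nonneg {κ : Type*} [Fintype κ] [DecidableEq κ]
    {M : Matrix (κ ⊕ Fin 2) (κ ⊕ Fin 2) ℝ} (hM : M.IsHermitian)
    (hA : (M.submatrix Sum.inl Sum.inl).PosDef)
    (hb : ∀ i, (M.submatrix (Sum.elim Sum.inl fun _ : Unit => Sum.inr i)
      (Sum.elim Sum.inl fun _ : Unit => Sum.inr i)).PosSemidef)
    (hdet : 0 ≤ M.det) : M.PosSemidef := by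
  set A := M.submatrix (Sum.inl : κ → κ ⊕ Fin 2) Sum.inl with hAdef
  set B := M.submatrix (Sum.inl : κ → κ ⊕ Fin 2) (Sum.inr : Fin 2 → κ ⊕ Fin 2) with hB
  set D := M.submatrix (Sum.inr : Fin 2 → κ ⊕ Fin 2) Sum.inr with hD
  have : Invertible A := hA.isUnit.invertible
  have hMb : M = fromBlocks A B Bᴴ D := by
    ext i j
    rcases i with i | i <;> rcases j with j | j <;> simp [A, B, D]
    simpa using (hM.apply (Sum.inr i) (Sum.inl j)).symm
  rw [hMb, PosDef.fromBlocks₁₁ B D hA]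
  refine posSemidef_fin_two_of_det_nonneg ?_ ?_ ?_
  · rw [hMb] at hM
    exact (IsHermitian.fromBlocks₁₁ B D hA.1).1 hM
  · intro i
    have h := hb i
    have e : M.submatrix (Sum.elim Sum.inl fun _ : Unit => Sum.inr i)
        (Sum.elim Sum.inl fun _ : Unit => Sum.inr i)
        = fromBlocks A (B.submatrix id fun _ : Unit => i) (B.submatrix id fun _ : Unit => i)ᴴ
          (D.submatrix (fun _ : Unit => i) fun _ : Unit => i) := by
      ext a b
      rcases a with a | a <;> rcases b with b | b <;> simp [A, B, D]
      simpa using (hM.apply (Sum.inr i) (Sum.inl b)).symm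
    rw [e, PosDef.fromBlocks₁₁ _ _ hA] at h
    exact h.diag_nonneg (i := ())
  · rw [hMb, det_fromBlocks₁₁, invOf_eq_nonsing_inv] at hdet
    exact nonneg_of_mul_nonneg_right hdet hA.det_pos

/-- Every matrix has an inner-saturated index set. -/
theorem exists_isInnerSaturatedSet {n : ℕ} (Y : Matrix (Fin n) (Fin n) ℝ) :
    ∃ I, IsInnerSaturatedSet Y I := by
  classical
  obtain ⟨κ, a, ha, hspan, hli⟩ := exists_linearIndependent' ℝ
    (fun j : {i : Fin n // 0 < (i : ℕ) ∧ (i : ℕ) < n - 1} =>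
      fun i : {i : Fin n // 0 < (i : ℕ) ∧ (i : ℕ) < n - 1} => Y i.val j.val)
  have : Finite κ := Finite.of_injective a ha
  have := Fintype.ofFinite κ
  let J : Finset (Fin n) := Finset.univ.image fun k => (a k).val
  let e : κ ≃ J := Equiv.ofBijective (fun k => ⟨(a k).val, by simp [J]⟩) ⟨
    fun k l h => ha (Subtype.ext (Subtype.mk.inj h)), by
      rintro ⟨j, hj⟩
      obtain ⟨k, -, rfl⟩ := Finset.mem_image.1 hj
      exact ⟨k, rfl⟩⟩
  refine ⟨_, J, ?_, ?_, ?_, rfl⟩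
  · intro j hj
    obtain ⟨k, -, rfl⟩ := Finset.mem_image.1 hj
    exact (a k).2
  · exact (linearIndependent_equiv e).1 hli
  · rw [← hspan, ← e.surjective.range_comp]
    rfl

/-- If `X` is a real symmetric `m × m` matrix (`m ≥ 2`) whose principal submatrices
`X_{1:(m-1),1:(m-1)}` and `X_{2:m,2:m}` are both positive semidefinite, then `X` is positive
semidefinite if and only if at least one inner-saturated submatrix of `X` has a nonnegative
determinant. -/
theorem stmt_5 (m : ℕ) (hm : 2 ≤ m) (X : Matrix (Fin m) (Fin m) ℝ) (hX : X.IsSymm)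
    (h1 : (leadSub X).PosSemidef) (h2 : (tailSub X).PosSemidef) :
    X.PosSemidef ↔
      ∃ I : Finset (Fin m), IsInnerSaturatedSet X I ∧ 0 ≤ (principalSub X I).det := by
  classical
  refine ⟨fun h => ?_, ?_⟩
  · obtain ⟨I, hI⟩ := exists_isInnerSaturatedSet X
    exact ⟨I, hI, (h.submatrix _).det_nonneg⟩
  rintro ⟨I, ⟨J, hJ, hli, hspan, hI⟩, hdet⟩
  have hherm : X.IsHermitian := (conjTranspose_eq_transpose_of_trivial X).trans hX
  have hlead : ∀ {ι : Type} (g : ι → Fin m), (∀ i, (g i : ℕ) < m - 1) →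
      (X.submatrix g g).PosSemidef := fun g hg =>
    h1.submatrix fun i => (⟨g i, hg i⟩ : Fin (m - 1))
  have htail : ∀ {ι : Type} (g : ι → Fin m), (∀ i, 0 < (g i : ℕ)) →
      (X.submatrix g g).PosSemidef := by
    intro ι g hg
    have e : X.submatrix g g = (tailSub X).submatrix
        (fun i => (⟨g i - 1, by have := (g i).2; have := hg i; omega⟩ : Fin (m - 1)))
        (fun i => (⟨g i - 1, by have := (g i).2; have := hg i; omega⟩ : Fin (m - 1))) := by
      ext i j
      simp only [tailSub, submatrix_apply]
      congr 1 <;> ext <;> [have := hg i; have := hg j] <;> simp only <;> omega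
    rw [e]
    exact h2.submatrix _
  -- A combination of the columns in `J`, as a vector on all indices.
  let ext0 : (J → ℝ) → Fin m → ℝ := fun c i => if h : i ∈ J then c ⟨i, h⟩ else 0
  have ext0_mul : ∀ c i, (X *ᵥ ext0 c) i = ∑ j : J, X i j * c j := by
    intro c i
    refine (Fintype.sum_of_injective (Subtype.val : J → Fin m) Subtype.val_injective
      (fun j => X i j * c j) (fun j => X i j * ext0 c j) ?_ ?_).symm
    · intro j hj
      have : j ∉ J := fun h => hj ⟨⟨j, h⟩, rfl⟩
      simp [ext0, this]
    · intro j
      simp [ext0]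
  have ext0_supp : ∀ c i, ext0 c i ≠ 0 → i ∈ J := by
    intro c i h
    by_contra h'
    simp [ext0, h'] at h
  have hA : (X.submatrix (Subtype.val : J → Fin m) Subtype.val).PosDef := by
    rw [(hlead (Subtype.val : J → Fin m) fun j => (hJ j j.2).2).posDef_iff_isUnit, ← mulVec_injective_iff_isUnit]
    refine (injective_iff_map_eq_zero (mulVecLin _)).2 fun c hc => ?_
    have hc' : ∀ i ∈ J, (X *ᵥ ext0 c) i = 0 := fun i hi => by
      rw [ext0_mul]
      exact congrFun hc ⟨i, hi⟩
    refine funext (Fintype.linearIndependent_iff.1 hli c (funext fun i => ?_))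
    have := mulVec_eq_zero_of_posSemidef_block (X := X) (fun i : Fin m => (i : ℕ) < m - 1)
      (hlead _ fun i => i.2) (fun i h => (hJ i (ext0_supp c i h)).2)
      (fun i h => hc' i (ext0_supp c i h)) i.2.2
    rw [ext0_mul] at this
    simpa [Finset.sum_apply, mul_comm] using this
  let f : J ⊕ Fin 2 → Fin m :=
    Sum.elim Subtype.val ![⟨0, by omega⟩, ⟨m - 1, by omega⟩]
  have hfI : ∀ i, f i ∈ I := by
    rintro (j | i)
    · simp [f, hI]
    · fin_cases i <;> simp [f, hI]
  have hfinj : Function.Injective f := by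
    refine Subtype.val_injective.sumElim ?_ ?_
    · intro a b h
      fin_cases a <;> fin_cases b <;> simp at h ⊢ <;> omega
    · intro j b h
      have := hJ j j.2
      fin_cases b <;> simp [h] at this
  have hfsurj : ∀ i ∈ I, ∃ k, f k = i := by
    intro i hi
    simp only [hI, Finset.mem_union, Finset.mem_filter, Finset.mem_univ, true_and] at hi
    rcases hi with (h | h) | h
    · exact ⟨Sum.inr 0, Fin.ext h.symm⟩
    · exact ⟨Sum.inr 1, Fin.ext h.symm⟩
    · exact ⟨Sum.inl ⟨i, h⟩, rfl⟩
  let e : J ⊕ Fin 2 ≃ I := Equiv.ofBijective (fun k => ⟨f k, hfI k⟩)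
    ⟨fun a b h => hfinj (congrArg Subtype.val h), fun i => by
      obtain ⟨k, hk⟩ := hfsurj i i.2
      exact ⟨k, Subtype.ext hk⟩⟩
  have hY : (X.submatrix f f).PosSemidef := by
    refine posSemidef_of_bordered_of_det_nonneg (hherm.submatrix f) hA ?_ ?_
    · intro i
      rw [submatrix_submatrix]
      fin_cases i
      · refine hlead _ ?_
        rintro (j | _)
        · exact (hJ j j.2).2
        · simp [f]
          omega
      · refine htail _ ?_
        rintro (j | _)
        · exact (hJ j j.2).1
        · simp [f]
          omega
    · rw [← det_submatrix_equiv_self e] at hdet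
      exact hdet
  have hcol : ∀ k, ∃ v : J ⊕ Fin 2 → ℝ, ∀ i, X i k = ∑ j, X i (f j) * v j := by
    intro k
    by_cases hk : k ∈ I
    · obtain ⟨l, rfl⟩ := hfsurj k hk
      exact ⟨Pi.single l 1, fun i => by simp [Pi.single_apply]⟩
    have hin : 0 < (k : ℕ) ∧ (k : ℕ) < m - 1 := by
      simp only [hI, Finset.mem_union, Finset.mem_filter, Finset.mem_univ, true_and] at hk
      have := k.2
      omega
    have hmem := Submodule.subset_span (R := ℝ) (Set.mem_range_self
      (f := fun j : {i : Fin m // 0 < (i : ℕ) ∧ (i : ℕ) < m - 1} =>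
        fun i : {i : Fin m // 0 < (i : ℕ) ∧ (i : ℕ) < m - 1} => X i.val j.val) ⟨k, hin⟩)
    rw [SetLike.mem_coe, ← hspan, Submodule.mem_span_range_iff_exists_fun] at hmem
    obtain ⟨c, hc⟩ := hmem
    refine ⟨Sum.elim c 0, fun i => ?_⟩
    let w : Fin m → ℝ := Pi.single k 1 - ext0 c
    have hw : ∀ i, (X *ᵥ w) i = X i k - ∑ j : J, X i j * c j := by
      intro i
      rw [mulVec_sub, Pi.sub_apply, ext0_mul]
      simp
    have hsupp : ∀ i, w i ≠ 0 → 0 < (i : ℕ) ∧ (i : ℕ) < m - 1 := by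
      intro i hi
      by_cases hik : i = k
      · rwa [hik]
      · exact hJ i (ext0_supp c i (by simpa [w, hik] using hi))
    have hzero : ∀ i, w i ≠ 0 → (X *ᵥ w) i = 0 := by
      intro i hi
      have := congrFun hc ⟨i, hsupp i hi⟩
      simp only [Finset.sum_apply, Pi.smul_apply, smul_eq_mul] at this
      simp [hw, ← this, mul_comm]
    have hXw : (X *ᵥ w) i = 0 := by
      by_cases hi : (i : ℕ) < m - 1
      · exact mulVec_eq_zero_of_posSemidef_block (fun i : Fin m => (i : ℕ) < m - 1)
          (hlead _ fun i => i.2) (fun i h => (hsupp i h).2) hzero hi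
      · exact mulVec_eq_zero_of_posSemidef_block (fun i : Fin m => 0 < (i : ℕ))
          (htail _ fun i => i.2) (fun i h => (hsupp i h).1) hzero (by omega)
    rw [hw, sub_eq_zero] at hXw
    simpa [f] using hXw
  choose V hV using hcol
  have hfac : X = (of V : Matrix _ _ ℝ) * X.submatrix f f * (of V : Matrix _ _ ℝ)ᴴ := by
    have hXV : X = X.submatrix id f * (of V : Matrix _ _ ℝ)ᴴ := by
      ext i k
      simpa [mul_apply] using hV k i
    have hVX : X.submatrix id f = (of V : Matrix _ _ ℝ) * X.submatrix f f := by
      ext i k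
      rw [submatrix_apply, ← hX.apply, id, hV i]
      simp [mul_apply, mul_comm, hX.apply]
    rw [← hVX]
    exact hXV
  rw [hfac]
  exact hY.mul_mul_conjTranspose_same _
end

section
/- Let X be a real symmetric m×m matrix with m ≥ 3 such that X_{1:(m−1),1:(m−1)} and X_{2:m,2:m} are positive semidefinite and the inner block X_{2:(m−1),2:(m−1)} is not invertible. Let I₁ and I₂ be two (possibly different) inner-saturated index sets of X, and for t ∈ ℝ let X(t) denote the matrix obtained from X by replacing the entries in positions (1,m) and (m,1) by t. Then there exists a constant k > 0 such that det((X(t))_{I₁,I₁}) = k · det((X(t))_{I₂,I₂}) for all t ∈ ℝ. -/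
open Matrix

/-- The inner principal submatrix `X_{2:(m-1),2:(m-1)}` (`0`-based: rows/cols `1,…,m-2`). -/
def innerSub {m : ℕ} (X : Matrix (Fin m) (Fin m) ℝ) : Matrix (Fin (m - 2)) (Fin (m - 2)) ℝ :=
  X.submatrix (fun i => ⟨(i : ℕ) + 1, by omega⟩) (fun i => ⟨(i : ℕ) + 1, by omega⟩)

/-- `X(t)`: the matrix obtained from `X` by replacing the entries in the two corner positions
`(1,m)` and `(m,1)` (i.e. `(0, m-1)` and `(m-1, 0)` in `0`-based indexing) by `t`. -/
def updCorner {m : ℕ} (X : Matrix (Fin m) (Fin m) ℝ) (t : ℝ) : Matrix (Fin m) (Fin m) ℝ :=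
  fun i j =>
    if ((i : ℕ) = 0 ∧ (j : ℕ) = m - 1) ∨ ((i : ℕ) = m - 1 ∧ (j : ℕ) = 0) then t else X i j

/-- If `v` vanishes at the two end indices and `X v` vanishes at the inner indices, then `X v = 0`
as soon as the leading and trailing blocks of `X` are positive semidefinite. -/
lemma mulVec_eq_zero_of_inner {n : ℕ} {X : Matrix (Fin (n + 1)) (Fin (n + 1)) ℝ}
    (h1 : (X.submatrix Fin.castSucc Fin.castSucc).PosSemidef)
    (h2 : (X.submatrix Fin.succ Fin.succ).PosSemidef) {v : Fin (n + 1) → ℝ}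
    (hv0 : v 0 = 0) (hvl : v (Fin.last n) = 0)
    (hin : ∀ i : Fin (n + 1), 0 < (i : ℕ) → (i : ℕ) < n → (X *ᵥ v) i = 0) :
    X *ᵥ v = 0 := by
  have hlead : ∀ i : Fin n, (X.submatrix Fin.castSucc Fin.castSucc *ᵥ fun j => v j.castSucc) i =
      (X *ᵥ v) i.castSucc := by
    intro i
    simp only [mulVec, dotProduct, Fin.sum_univ_castSucc (n := n), hvl, mul_zero, add_zero]
    rfl
  have htail : ∀ i : Fin n, (X.submatrix Fin.succ Fin.succ *ᵥ fun j => v j.succ) i =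
      (X *ᵥ v) i.succ := by
    intro i
    simp only [mulVec, dotProduct, Fin.sum_univ_succ (n := n), hv0, mul_zero, zero_add]
    rfl
  have hvX : ∀ i, v i * (X *ᵥ v) i = 0 := by
    intro i
    rcases Nat.eq_zero_or_pos (i : ℕ) with hi | hi
    · rw [show i = 0 from Fin.ext hi, hv0, zero_mul]
    · rcases Nat.lt_or_ge (i : ℕ) n with hi' | hi'
      · rw [hin i hi hi', mul_zero]
      · rw [show i = Fin.last n from Fin.ext (by simp; omega), hvl, zero_mul]
  have hl0 : X.submatrix Fin.castSucc Fin.castSucc *ᵥ (fun j : Fin n => v j.castSucc) = 0 := by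
    refine (h1.dotProduct_mulVec_zero_iff _).1 (Finset.sum_eq_zero fun i _ => ?_)
    rw [hlead]
    exact hvX _
  have ht0 : X.submatrix Fin.succ Fin.succ *ᵥ (fun j : Fin n => v j.succ) = 0 := by
    refine (h2.dotProduct_mulVec_zero_iff _).1 (Finset.sum_eq_zero fun i _ => ?_)
    rw [htail]
    exact hvX _
  funext i
  rcases Nat.lt_or_ge (i : ℕ) n with hi | hi
  · have := hlead ⟨i, hi⟩
    rw [hl0] at this
    exact this.symm
  · rcases Nat.eq_zero_or_pos n with hn | hn
    · subst hn
      simp [mulVec, dotProduct, hv0]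
    · have := htail ⟨i - 1, by omega⟩
      rw [ht0, show Fin.succ (⟨i - 1, by omega⟩ : Fin n) = i from
        Fin.ext (by simp only [Fin.val_succ]; omega)] at this
      exact this.symm

/-- Every column of `X(t)` is a combination, with coefficients independent of `t`, of the columns
indexed by an inner-saturated set. -/
lemma IsInnerSaturatedSet.exists_col_combination {n : ℕ}
    {X : Matrix (Fin (n + 1)) (Fin (n + 1)) ℝ}
    (h1 : (leadSub X).PosSemidef) (h2 : (tailSub X).PosSemidef)
    {I : Finset (Fin (n + 1))} (hI : IsInnerSaturatedSet X I) (j : Fin (n + 1)) :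
    ∃ q : I → ℝ, ∀ t a, updCorner X t a j = ∑ i : I, updCorner X t a i * q i := by
  classical
  by_cases hjI : j ∈ I
  · exact ⟨Pi.single ⟨j, hjI⟩ 1, fun t a => by simp [Pi.single_apply]⟩
  obtain ⟨J, hJ, -, hspan, rfl⟩ := hI
  simp only [Nat.add_sub_cancel] at hJ hspan hjI
  have hj : 0 < (j : ℕ) ∧ (j : ℕ) < n := by
    simp only [Finset.mem_union, Finset.mem_filter, Finset.mem_univ, true_and] at hjI
    omega
  have hmem := hspan.symm.le (Submodule.subset_span ⟨⟨j, hj⟩, rfl⟩)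
  obtain ⟨c, hc⟩ := (Submodule.mem_span_range_iff_exists_fun ℝ).1 hmem
  set q : Fin (n + 1) → ℝ := fun i => if h : i ∈ J then c ⟨i, h⟩ else 0 with hq
  have hqJ : ∀ i, i ∉ J → q i = 0 := fun i hi => dif_neg hi
  have hsum : ∀ f : Fin (n + 1) → ℝ, ∑ i, f i * q i = ∑ i : J, f i * c i := by
    intro f
    rw [← Finset.sum_subset (Finset.subset_univ J) fun i _ hi => by rw [hqJ i hi, mul_zero],
      ← Finset.sum_coe_sort J]
    exact Finset.sum_congr rfl fun i _ => by simp [hq]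
  have hend : ∀ i : Fin (n + 1), (i : ℕ) = 0 ∨ (i : ℕ) = n →
      (q - (Pi.single j 1 : Fin (n + 1) → ℝ)) i = 0 := by
    intro i hi
    have hij : i ≠ j := by rintro rfl; omega
    have hiJ : i ∉ J := fun h => by have := hJ i h; omega
    simp [hij, hqJ i hiJ]
  have hXv : X *ᵥ (q - (Pi.single j 1 : Fin (n + 1) → ℝ)) = 0 := by
    refine mulVec_eq_zero_of_inner h1 h2 (hend _ (by simp)) (hend _ (by simp)) ?_
    intro i hi hi'
    have := congrFun hc ⟨i, hi, hi'⟩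
    simp only [Finset.sum_apply, Pi.smul_apply, smul_eq_mul] at this
    rw [mulVec_sub, Pi.sub_apply, mulVec_single_one, col_apply, ← this, mulVec, dotProduct,
      hsum]
    simp [mul_comm]
  refine ⟨fun i => q i, fun t a => ?_⟩
  have hUv : ∑ i, updCorner X t a i * (q - (Pi.single j 1 : Fin (n + 1) → ℝ)) i = 0 := by
    refine (Finset.sum_congr rfl fun i _ => ?_).trans (congrFun hXv a)
    by_cases hi : (i : ℕ) = 0 ∨ (i : ℕ) = n
    · simp [hend i hi]
    · rw [updCorner, if_neg (by omega)]
  simp only [Pi.sub_apply, mul_sub, Finset.sum_sub_distrib] at hUv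
  rw [Finset.sum_coe_sort _ fun i => updCorner X t a i * q i,
    Finset.sum_subset (Finset.subset_univ _) fun i _ hi => by
      rw [hqJ i fun h => hi (Finset.mem_union_right _ h), mul_zero]]
  simp [Pi.single_apply] at hUv
  linarith

lemma IsInnerSaturatedSet.card_eq {m : ℕ} {X : Matrix (Fin m) (Fin m) ℝ} {I₁ I₂ : Finset (Fin m)}
    (hI₁ : IsInnerSaturatedSet X I₁) (hI₂ : IsInnerSaturatedSet X I₂) :
    I₁.card = I₂.card := by
  obtain ⟨J₁, hJ₁, hli₁, hs₁, rfl⟩ := hI₁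
  obtain ⟨J₂, hJ₂, hli₂, hs₂, rfl⟩ := hI₂
  have hdisj : ∀ J : Finset (Fin m), (∀ j ∈ J, 0 < (j : ℕ) ∧ (j : ℕ) < m - 1) →
      Disjoint (Finset.univ.filter fun i : Fin m => (i : ℕ) = 0 ∨ (i : ℕ) = m - 1) J := by
    intro J hJ
    refine Finset.disjoint_left.2 fun i hi hiJ => ?_
    have := hJ i hiJ
    simp only [Finset.mem_filter, Finset.mem_univ, true_and] at hi
    omega
  rw [Finset.card_union_of_disjoint (hdisj _ hJ₁), Finset.card_union_of_disjoint (hdisj _ hJ₂)]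
  have e₁ := finrank_span_eq_card hli₁
  have e₂ := finrank_span_eq_card hli₂
  rw [hs₁] at e₁
  rw [hs₂, e₁] at e₂
  simpa using e₂

lemma updCorner_isSymm {m : ℕ} {X : Matrix (Fin m) (Fin m) ℝ} (hX : X.IsSymm) (t : ℝ) :
    (updCorner X t).IsSymm := by
  refine IsSymm.ext fun i j => ?_
  simp only [updCorner, hX.apply i j]
  congr 1
  exact propext (by tauto)

/-- If all columns of every member of a family of symmetric matrices are the same combinations of
the columns indexed by `I`, then the minors on equipotent index sets `I'` and `I` differ by a square
that is common to the whole family. -/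
lemma exists_det_principalSub_eq {m : ℕ} {T : Type*} {Y : T → Matrix (Fin m) (Fin m) ℝ}
    (hY : ∀ t, (Y t).IsSymm) {I I' : Finset (Fin m)} (hcard : I.card = I'.card)
    (hcol : ∀ j, ∃ q : I → ℝ, ∀ t a, Y t a j = ∑ i : I, Y t a i * q i) :
    ∃ d : ℝ, ∀ t, (principalSub (Y t) I').det = d ^ 2 * (principalSub (Y t) I).det := by
  choose q hq using hcol
  let e : I ≃ I' := Finset.equivOfCardEq hcard
  let Q : Matrix I I ℝ := Matrix.of fun i j => q (e j) i
  refine ⟨Q.det, fun t => ?_⟩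
  have key : (principalSub (Y t) I').submatrix e e = Qᵀ * principalSub (Y t) I * Q := by
    ext i j
    simp only [submatrix_apply, principalSub, mul_apply, transpose_apply, Q, of_apply]
    rw [hq]
    refine Finset.sum_congr rfl fun k _ => ?_
    rw [← (hY t).apply, hq]
    congr 1
    exact Finset.sum_congr rfl fun l _ => by rw [(hY t).apply, mul_comm]
  rw [← det_submatrix_equiv_self e, key, det_mul, det_mul, det_transpose]
  ring

/-- Let `X` be a real symmetric `m × m` matrix (`m ≥ 3`) such that `X_{1:(m-1),1:(m-1)}` and
`X_{2:m,2:m}` are positive semidefinite and the inner block `X_{2:(m-1),2:(m-1)}` is not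
invertible. If `I₁, I₂` are two inner-saturated index sets of `X`, then there is a constant
`k > 0` with `det ((X(t))_{I₁,I₁}) = k · det ((X(t))_{I₂,I₂})` for all `t`. -/
theorem stmt_11 (m : ℕ) (hm : 3 ≤ m) (X : Matrix (Fin m) (Fin m) ℝ) (hX : X.IsSymm)
    (h1 : (leadSub X).PosSemidef) (h2 : (tailSub X).PosSemidef)
    (h3 : ¬ IsUnit (innerSub X))
    (I₁ I₂ : Finset (Fin m))
    (hI₁ : IsInnerSaturatedSet X I₁) (hI₂ : IsInnerSaturatedSet X I₂) :
    ∃ k : ℝ, 0 < k ∧ ∀ t : ℝ,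
      (principalSub (updCorner X t) I₁).det = k * (principalSub (updCorner X t) I₂).det := by
  obtain ⟨n, rfl⟩ : ∃ n, m = n + 1 := ⟨m - 1, by omega⟩
  have hcard := hI₁.card_eq hI₂
  obtain ⟨d, hd⟩ := exists_det_principalSub_eq (updCorner_isSymm hX) hcard.symm
    (hI₂.exists_col_combination h1 h2)
  obtain ⟨d', hd'⟩ := exists_det_principalSub_eq (updCorner_isSymm hX) hcard
    (hI₁.exists_col_combination h1 h2)
  rcases eq_or_ne d 0 with rfl | hne
  · refine ⟨1, one_pos, fun t => ?_⟩
    rw [hd' t, hd t]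
    ring
  · exact ⟨d ^ 2, by positivity, hd⟩
end
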